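/- (Theorem 1) Let N ≥ 2, let b_1,…,b_N be real parameters, and let 𝓗 : ℝ³ → ℝ be any smooth function. On the open subset of ℝ^{2N} where every q_i ≠ 0, define the Hamiltonian H = 𝓗( Σ_{i=1}^N q_i², Σ_{i=1}^N (p_i² + b_i/q_i²), Σ_{i=1}^N q_i p_i ). Then H Poisson-commutes with each of the 2N−3 functions C^{(m)} = Σ_{1≤i<j≤m}[(q_i p_j − q_j p_i)² + b_i q_j²/q_i² + b_j q_i²/q_j²] + Σ_{i=1}^m b_i and C_{(m)} = Σ_{N−m+1≤i<j≤N}[(q_i p_j − q_j p_i)² + b_i q_j²/q_i² + b_j q_i²/q_j²] + Σ_{i=N−m+1}^N b_i (for 2 ≤ m ≤ N, where C^{(N)} = C_{(N)}); moreover each of the two sets of N functions {H, C^{(2)},…,C^{(N)}} and {H, C_{(2)},…,C_{(N)}} is in involution. -/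

import Mathlib

open scoped BigOperators
open Real

noncomputable section

/-- Phase space ℝ^{2N} with canonical coordinates (q, p). -/
abbrev Phase (N : ℕ) : Type := (Fin N → ℝ) × (Fin N → ℝ)

/-- The canonical Poisson bracket
`{f,g} = ∑ i, (∂f/∂q_i · ∂g/∂p_i − ∂g/∂q_i · ∂f/∂p_i)`. -/
noncomputable def pb {N : ℕ} (f g : Phase N → ℝ) (x : Phase N) : ℝ :=
  ∑ i : Fin N,
    ((fderiv ℝ f x) (Pi.single i 1, 0) * (fderiv ℝ g x) (0, Pi.single i 1)
      - (fderiv ℝ g x) (Pi.single i 1, 0) * (fderiv ℝ f x) (0, Pi.single i 1))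

/-- `J_- = Σ q_i²`. -/
noncomputable def Jm (N : ℕ) : Phase N → ℝ := fun x => ∑ i : Fin N, (x.1 i) ^ 2

/-- `J_+ = Σ (p_i² + b_i/q_i²)`. -/
noncomputable def Jp (N : ℕ) (b : Fin N → ℝ) : Phase N → ℝ :=
  fun x => ∑ i : Fin N, ((x.2 i) ^ 2 + b i / (x.1 i) ^ 2)

/-- `J_3 = Σ q_i p_i`. -/
noncomputable def J3 (N : ℕ) : Phase N → ℝ := fun x => ∑ i : Fin N, x.1 i * x.2 i

/-- The "left" integrals `C^{(m)}` (indices `1 ≤ i < j ≤ m` of the paper are the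
0-indexed `i < j < m` here). -/
noncomputable def Cleft (N : ℕ) (b : Fin N → ℝ) (m : ℕ) : Phase N → ℝ :=
  fun x =>
    (∑ i : Fin N, ∑ j : Fin N, if (i : ℕ) < (j : ℕ) ∧ (j : ℕ) < m then
        (x.1 i * x.2 j - x.1 j * x.2 i) ^ 2
          + b i * (x.1 j) ^ 2 / (x.1 i) ^ 2 + b j * (x.1 i) ^ 2 / (x.1 j) ^ 2
      else 0)
    + ∑ i : Fin N, if (i : ℕ) < m then b i else 0

/-- The "right" integrals `C_{(m)}` (indices `N−m+1 ≤ i < j ≤ N` of the paper are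
the 0-indexed `N−m ≤ i < j` here). -/
noncomputable def Cright (N : ℕ) (b : Fin N → ℝ) (m : ℕ) : Phase N → ℝ :=
  fun x =>
    (∑ i : Fin N, ∑ j : Fin N, if N - m ≤ (i : ℕ) ∧ (i : ℕ) < (j : ℕ) then
        (x.1 i * x.2 j - x.1 j * x.2 i) ^ 2
          + b i * (x.1 j) ^ 2 / (x.1 i) ^ 2 + b j * (x.1 i) ^ 2 / (x.1 j) ^ 2
      else 0)
    + ∑ i : Fin N, if N - m ≤ (i : ℕ) then b i else 0

/-- `Σ_{i ∈ S} q_i²`. -/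
def partialJm {N : ℕ} (S : Finset (Fin N)) (x : Phase N) : ℝ := ∑ i ∈ S, (x.1 i) ^ 2

/-- `Σ_{i ∈ S} (p_i² + b_i/q_i²)`. -/
def partialJp {N : ℕ} (b : Fin N → ℝ) (S : Finset (Fin N)) (x : Phase N) : ℝ :=
  ∑ i ∈ S, ((x.2 i) ^ 2 + b i / (x.1 i) ^ 2)

/-- `Σ_{i ∈ S} q_i p_i`. -/
def partialJ3 {N : ℕ} (S : Finset (Fin N)) (x : Phase N) : ℝ := ∑ i ∈ S, x.1 i * x.2 i

/-- The `sl(2)` Casimir `J_- J_+ - J_3²` restricted to the sites in `S`. -/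
def partialCasimir {N : ℕ} (b : Fin N → ℝ) (S : Finset (Fin N)) (x : Phase N) : ℝ :=
  partialJm S x * partialJp b S x - partialJ3 S x ^ 2

/-- The `i`-th position coordinate as a continuous linear functional. -/
def posCoord {N : ℕ} (i : Fin N) : Phase N →L[ℝ] ℝ :=
  (ContinuousLinearMap.proj i).comp (ContinuousLinearMap.fst ℝ (Fin N → ℝ) (Fin N → ℝ))

/-- The `i`-th momentum coordinate as a continuous linear functional. -/
def momCoord {N : ℕ} (i : Fin N) : Phase N →L[ℝ] ℝ :=
  (ContinuousLinearMap.proj i).comp (ContinuousLinearMap.snd ℝ (Fin N → ℝ) (Fin N → ℝ))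

@[simp] lemma posCoord_apply {N : ℕ} (i : Fin N) (x : Phase N) : posCoord i x = x.1 i := rfl

@[simp] lemma momCoord_apply {N : ℕ} (i : Fin N) (x : Phase N) : momCoord i x = x.2 i := rfl

lemma hasFDerivAt_partialJm {N : ℕ} (S : Finset (Fin N)) (x : Phase N) :
    HasFDerivAt (partialJm S) (∑ i ∈ S, (2 * x.1 i) • posCoord i) x := by
  refine HasFDerivAt.fun_sum fun i _ => ?_
  simpa using (posCoord i).hasFDerivAt.pow (x := x) 2

lemma hasFDerivAt_partialJ3 {N : ℕ} (S : Finset (Fin N)) (x : Phase N) :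
    HasFDerivAt (partialJ3 S) (∑ i ∈ S, (x.1 i • momCoord i + x.2 i • posCoord i)) x :=
  HasFDerivAt.fun_sum fun i _ =>
    (posCoord i).hasFDerivAt.mul (x := x) (momCoord i).hasFDerivAt

lemma hasFDerivAt_partialJp {N : ℕ} (b : Fin N → ℝ) (S : Finset (Fin N)) (x : Phase N)
    (hx : ∀ i, x.1 i ≠ 0) :
    HasFDerivAt (partialJp b S)
      (∑ i ∈ S, ((2 * x.2 i) • momCoord i + (-2 * b i / x.1 i ^ 3) • posCoord i)) x := by
  refine HasFDerivAt.fun_sum fun i _ => HasFDerivAt.add ?_ ?_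
  · simpa using (momCoord i).hasFDerivAt.pow (x := x) 2
  · have h : HasDerivAt (fun t : ℝ => b i / t ^ 2) (-2 * b i / x.1 i ^ 3) (x.1 i) := by
      have hi := hx i
      refine ((hasDerivAt_const (x.1 i) (b i)).div (hasDerivAt_pow 2 (x.1 i))
        (by positivity)).congr_deriv ?_
      push_cast
      field_simp
      ring
    exact h.comp_hasFDerivAt (f := fun y : Phase N => y.1 i) x (posCoord i).hasFDerivAt

lemma sum_smul_posCoord_apply {N : ℕ} (S : Finset (Fin N)) (v : Fin N → ℝ) (y : Phase N) :
    (∑ i ∈ S, v i • posCoord i) y = ∑ i ∈ S, v i * y.1 i := by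
  simp

lemma sum_smul_coord_apply {N : ℕ} (S : Finset (Fin N)) (u v : Fin N → ℝ) (y : Phase N) :
    (∑ i ∈ S, (u i • momCoord i + v i • posCoord i)) y = ∑ i ∈ S, (u i * y.2 i + v i * y.1 i) := by
  simp

lemma sum_mul_single {N : ℕ} (S : Finset (Fin N)) (v : Fin N → ℝ) (i : Fin N) :
    ∑ j ∈ S, v j * (Pi.single i 1 : Fin N → ℝ) j = if i ∈ S then v i else 0 := by
  simp [Pi.single_apply]

lemma pb_comm {N : ℕ} (f g : Phase N → ℝ) (x : Phase N) : pb f g x = -pb g f x := by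
  simp only [pb, ← Finset.sum_neg_distrib, neg_sub]

lemma pb_congr {N : ℕ} {f f' g g' : Phase N → ℝ} {x : Phase N}
    (hf : f =ᶠ[nhds x] f') (hg : g =ᶠ[nhds x] g') : pb f g x = pb f' g' x := by
  simp only [pb, hf.fderiv_eq, hg.fderiv_eq]

/-- A function of the generators supported on `T` Poisson-commutes with the Casimir supported
on any `S ⊆ T`. -/
lemma pb_comp_partialCasimir_eq_zero {N : ℕ} (b : Fin N → ℝ) {S T : Finset (Fin N)} (hST : S ⊆ T)
    (F : ℝ × ℝ × ℝ → ℝ) (x : Phase N) (hx : ∀ i, x.1 i ≠ 0)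
    (hF : DifferentiableAt ℝ F (partialJm T x, partialJp b T x, partialJ3 T x)) :
    pb (fun y => F (partialJm T y, partialJp b T y, partialJ3 T y)) (partialCasimir b S) x = 0 := by
  have hf := hF.hasFDerivAt.comp x ((hasFDerivAt_partialJm T x).prodMk
    ((hasFDerivAt_partialJp b T x hx).prodMk (hasFDerivAt_partialJ3 T x)))
  have hC := ((hasFDerivAt_partialJm S x).mul (hasFDerivAt_partialJp b S x hx)).sub
    ((hasFDerivAt_partialJ3 S x).pow 2)
  set L := fderiv ℝ F (partialJm T x, partialJp b T x, partialJ3 T x)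
  have hL (r s t : ℝ) : L (r, s, t) = r * L (1, 0, 0) + s * L (0, 1, 0) + t * L (0, 0, 1) := by
    have h : ((r, s, t) : ℝ × ℝ × ℝ) = r • (1, 0, 0) + s • (0, 1, 0) + t • (0, 0, 1) := by simp
    rw [h]
    simp only [map_add, map_smul, smul_eq_mul]
  have hfv (v : Phase N) :
      fderiv ℝ (fun y => F (partialJm T y, partialJp b T y, partialJ3 T y)) x v
      = (∑ i ∈ T, (2 * x.1 i) • posCoord i) v * L (1, 0, 0)
        + (∑ i ∈ T, ((2 * x.2 i) • momCoord i + (-2 * b i / x.1 i ^ 3) • posCoord i)) v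
          * L (0, 1, 0)
        + (∑ i ∈ T, (x.1 i • momCoord i + x.2 i • posCoord i)) v * L (0, 0, 1) := by
    rw [HasFDerivAt.fderiv (f := fun y => F (partialJm T y, partialJp b T y, partialJ3 T y)) hf]
    exact hL _ _ _
  have key (i : Fin N) :
      fderiv ℝ (fun y => F (partialJm T y, partialJp b T y, partialJ3 T y)) x (Pi.single i 1, 0)
          * fderiv ℝ (partialCasimir b S) x (0, Pi.single i 1)
        - fderiv ℝ (partialCasimir b S) x (Pi.single i 1, 0)
          * fderiv ℝ (fun y => F (partialJm T y, partialJp b T y, partialJ3 T y)) x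
            (0, Pi.single i 1)
      = if i ∈ S then
          4 * L (1, 0, 0) * (partialJm S x * (x.1 i * x.2 i) - partialJ3 S x * x.1 i ^ 2)
          + 4 * L (0, 1, 0) * (partialJ3 S x * (x.2 i ^ 2 + b i / x.1 i ^ 2)
            - partialJp b S x * (x.1 i * x.2 i))
          + 2 * L (0, 0, 1) * (partialJm S x * (x.2 i ^ 2 + b i / x.1 i ^ 2)
            - partialJp b S x * x.1 i ^ 2) else 0 := by
    rw [HasFDerivAt.fderiv (f := partialCasimir b S) hC]
    have hi := hx i
    simp only [hfv, sub_apply, add_apply, smul_apply, smul_eq_mul, sum_smul_coord_apply,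
      sum_smul_posCoord_apply, Pi.zero_apply, mul_zero, add_zero, zero_add, sum_mul_single,
      Finset.sum_const_zero]
    by_cases hS : i ∈ S
    · simp only [hS, hST hS, if_true]
      field_simp
      ring
    · simp [hS]
  rw [pb, Finset.sum_congr rfl fun i _ => key i, Finset.sum_ite_mem, Finset.univ_inter]
  simp only [Finset.sum_add_distrib, ← Finset.mul_sum, Finset.sum_sub_distrib]
  simp only [← Finset.sum_add_distrib]
  change 4 * L (1, 0, 0) * (partialJm S x * partialJ3 S x - partialJ3 S x * partialJm S x)
    + 4 * L (0, 1, 0) * (partialJ3 S x * partialJp b S x - partialJp b S x * partialJ3 S x)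
    + 2 * L (0, 0, 1) * (partialJm S x * partialJp b S x - partialJp b S x * partialJm S x) = 0
  ring

lemma pb_partialCasimir_eq_zero {N : ℕ} (b : Fin N → ℝ) {S T : Finset (Fin N)} (hST : S ⊆ T)
    (x : Phase N) (hx : ∀ i, x.1 i ≠ 0) :
    pb (partialCasimir b S) (partialCasimir b T) x = 0 := by
  rw [pb_comm, neg_eq_zero]
  exact pb_comp_partialCasimir_eq_zero b hST (fun y => y.1 * y.2.1 - y.2.2 ^ 2) x hx (by fun_prop)

/-- A double sum over a finite set, split along the diagonal. -/
lemma sum_sum_eq_sum_lt_add_sum_diag {N : ℕ} (S : Finset (Fin N)) (g : Fin N → Fin N → ℝ) :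
    ∑ i ∈ S, ∑ j ∈ S, g i j
      = (∑ i, ∑ j, if i < j ∧ i ∈ S ∧ j ∈ S then g i j + g j i else 0) + ∑ i ∈ S, g i i := by
  have hsplit (i j : Fin N) : (if i ∈ S then if j ∈ S then g i j else 0 else 0)
      = (if i < j ∧ i ∈ S ∧ j ∈ S then g i j else 0)
        + (if j < i ∧ j ∈ S ∧ i ∈ S then g i j else 0)
        + (if i = j then if i ∈ S then g i i else 0 else 0) := by
    rcases lt_trichotomy i j with h | rfl | h
    · simp [h, h.not_gt, h.ne, ite_and]
    · simp +contextual
    · simp only [h, h.not_gt, h.ne', true_and, false_and, if_false, zero_add, add_zero, ite_and]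
      split_ifs <;> rfl
  have hlhs : ∑ i ∈ S, ∑ j ∈ S, g i j
      = ∑ i, ∑ j, if i ∈ S then if j ∈ S then g i j else 0 else 0 := by
    simp [Finset.sum_ite_mem]
  have hswap : ∑ i, ∑ j, (if j < i ∧ j ∈ S ∧ i ∈ S then g i j else 0)
      = ∑ i, ∑ j, if i < j ∧ i ∈ S ∧ j ∈ S then g j i else 0 := Finset.sum_comm
  rw [hlhs]
  simp only [hsplit, Finset.sum_add_distrib, hswap]
  simp only [ite_add_zero, Finset.sum_add_distrib]
  simp

/-- Expansion of the Casimir as a sum over pairs of sites. -/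
lemma partialCasimir_eq {N : ℕ} (b : Fin N → ℝ) (S : Finset (Fin N)) (x : Phase N)
    (hx : ∀ i, x.1 i ≠ 0) :
    partialCasimir b S x =
      (∑ i, ∑ j, if i < j ∧ i ∈ S ∧ j ∈ S then
        (x.1 i * x.2 j - x.1 j * x.2 i) ^ 2
          + b i * (x.1 j) ^ 2 / (x.1 i) ^ 2 + b j * (x.1 i) ^ 2 / (x.1 j) ^ 2 else 0)
      + ∑ i ∈ S, b i := by
  have h := sum_sum_eq_sum_lt_add_sum_diag S fun i j =>
    x.1 i ^ 2 * (x.2 j ^ 2 + b j / x.1 j ^ 2) - x.1 i * x.2 i * (x.1 j * x.2 j)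
  rw [partialCasimir, sq, partialJm, partialJp, partialJ3, Finset.sum_mul_sum, Finset.sum_mul_sum,
    ← Finset.sum_sub_distrib]
  simp only [← Finset.sum_sub_distrib]
  rw [h]
  congr 1
  · refine Finset.sum_congr rfl fun i _ => Finset.sum_congr rfl fun j _ => ?_
    congr 1
    ring
  · refine Finset.sum_congr rfl fun i _ => ?_
    have hi := hx i
    field_simp
    ring

lemma Cleft_eq_partialCasimir {N : ℕ} (b : Fin N → ℝ) (m : ℕ) (x : Phase N)
    (hx : ∀ i, x.1 i ≠ 0) :
    Cleft N b m x = partialCasimir b {i | (i : ℕ) < m} x := by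
  rw [partialCasimir_eq b _ x hx, Cleft, Finset.sum_filter]
  congr 1
  refine Finset.sum_congr rfl fun i _ => Finset.sum_congr rfl fun j _ => if_congr ?_ rfl rfl
  simp only [Finset.mem_filter_univ, Fin.lt_def]
  omega

lemma Cright_eq_partialCasimir {N : ℕ} (b : Fin N → ℝ) (m : ℕ) (x : Phase N)
    (hx : ∀ i, x.1 i ≠ 0) :
    Cright N b m x = partialCasimir b {i | N - m ≤ (i : ℕ)} x := by
  rw [partialCasimir_eq b _ x hx, Cright, Finset.sum_filter]
  congr 1
  refine Finset.sum_congr rfl fun i _ => Finset.sum_congr rfl fun j _ => if_congr ?_ rfl rfl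
  simp only [Finset.mem_filter_univ, Fin.lt_def]
  omega

lemma eventually_pos_ne_zero {N : ℕ} (x : Phase N) (hx : ∀ i, x.1 i ≠ 0) :
    ∀ᶠ y : Phase N in nhds x, ∀ i, y.1 i ≠ 0 :=
  Filter.eventually_all.2 fun i => (posCoord i).continuous.continuousAt.eventually_ne (hx i)

/-- Theorem 1: for any smooth `𝓗 : ℝ³ → ℝ`, the Hamiltonian
`H = 𝓗(Σ q_i², Σ(p_i² + b_i/q_i²), Σ q_i p_i)` Poisson-commutes with each of the
`2N−3` integrals `C^{(m)}`, `C_{(m)}` (`2 ≤ m ≤ N`, with `C^{(N)} = C_{(N)}`),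
and each of the two sets `{H, C^{(2)},…,C^{(N)}}` and `{H, C_{(2)},…,C_{(N)}}`
is in involution. -/
theorem theorem1_QMS (N : ℕ) (hN : 2 ≤ N) (b : Fin N → ℝ)
    (𝓗 : ℝ × ℝ × ℝ → ℝ) (h𝓗 : ContDiff ℝ (⊤ : ℕ∞) 𝓗)
    (H : Phase N → ℝ) (hH : H = fun x => 𝓗 (Jm N x, Jp N b x, J3 N x))
    (x : Phase N) (hx : ∀ i, x.1 i ≠ 0) :
    (∀ m : ℕ, 2 ≤ m → m ≤ N →
      pb H (Cleft N b m) x = 0 ∧ pb H (Cright N b m) x = 0) ∧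
    Cleft N b N x = Cright N b N x ∧
    (∀ m k : ℕ, 2 ≤ m → m ≤ N → 2 ≤ k → k ≤ N →
      pb (Cleft N b m) (Cleft N b k) x = 0 ∧
      pb (Cright N b m) (Cright N b k) x = 0) := by
  have hne := eventually_pos_ne_zero x hx
  have hl (m : ℕ) : Cleft N b m =ᶠ[nhds x] partialCasimir b {i | (i : ℕ) < m} :=
    hne.mono fun y hy => Cleft_eq_partialCasimir b m y hy
  have hr (m : ℕ) : Cright N b m =ᶠ[nhds x] partialCasimir b {i | N - m ≤ (i : ℕ)} :=
    hne.mono fun y hy => Cright_eq_partialCasimir b m y hy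
  have hcomm (S : Finset (Fin N)) : pb H (partialCasimir b S) x = 0 := by
    rw [hH]
    exact pb_comp_partialCasimir_eq_zero b S.subset_univ 𝓗 x hx
      (h𝓗.differentiable (by simp) _)
  refine ⟨fun m _ _ => ⟨?_, ?_⟩, ?_, fun m k _ _ _ _ => ⟨?_, ?_⟩⟩
  · rw [pb_congr .rfl (hl m), hcomm]
  · rw [pb_congr .rfl (hr m), hcomm]
  · rw [Cleft_eq_partialCasimir b N x hx, Cright_eq_partialCasimir b N x hx]
    simp
  · rw [pb_congr (hl m) (hl k)]
    rcases le_total m k with h | h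
    · exact pb_partialCasimir_eq_zero b (Finset.monotone_filter_right _ fun i _ => by grind) x hx
    · rw [pb_comm, neg_eq_zero]
      exact pb_partialCasimir_eq_zero b (Finset.monotone_filter_right _ fun i _ => by grind) x hx
  · rw [pb_congr (hr m) (hr k)]
    rcases le_total m k with h | h
    · exact pb_partialCasimir_eq_zero b (Finset.monotone_filter_right _ fun i _ => by grind) x hx
    · rw [pb_comm, neg_eq_zero]
      exact pb_partialCasimir_eq_zero b (Finset.monotone_filter_right _ fun i _ => by grind) x hx
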